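/- arXiv:1108.2852 — 2 statements merged into one kernel-verified Lean document; each statement's English description precedes it below -/
import Mathlib

section
/- Let 1 ≤ d ≤ r and 0 ≤ k ≤ r be integers. Then g^{r,d}_k ≤ g^{r+1,d}_k componentwise, i.e., every entry of g^{r,d}_k is less than or equal to the corresponding entry of g^{r+1,d}_k. -/
/-- `vC r d i` is the number of tuples `(u₁,…,u_d) ∈ ℤ^d` with `0 ≤ uₗ ≤ r` for all `l`
and `u₁ + ⋯ + u_d = i`.  For `d = 0` this is `1` if `i = 0` and `0` otherwise. -/
def vC (r d : ℕ) (i : ℤ) : ℕ :=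
  (Finset.univ.filter fun u : Fin d → Fin (r + 1) => (∑ l, ((u l : ℕ) : ℤ)) = i).card

/-- `gHat r d k i` is the `(i+1)`-st entry (`0 ≤ i ≤ ⌊d/2⌋+1`) of the vector
`ĝ^{r,d}_k ∈ ℤ^{⌊d/2⌋+2}`, defined by `g₀ = C(r−1,d,−k)` and
`g_i = C(r−1,d,ir−k) − C(r−1,d,(i−1)r−k)` for `i ≥ 1`; for `k ≥ r` the vector
`ĝ^{r,d}_k` is the zero vector.  The vector `g^{r,d}_k ∈ ℤ^{⌊d/2⌋+1}` is obtained
from `ĝ^{r,d}_k` by deleting its last entry, so its entries are `gHat r d k i`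
for `0 ≤ i ≤ ⌊d/2⌋`; `last (g^{r,d}_k) = gHat r d k (d/2)` and
`last (ĝ^{r,d}_k) = gHat r d k (d/2 + 1)`. -/
def gHat (r d k : ℕ) (i : ℕ) : ℤ :=
  if r ≤ k then 0
  else if i = 0 then (vC (r - 1) d (-(k : ℤ)) : ℤ)
  else (vC (r - 1) d ((i : ℤ) * (r : ℤ) - (k : ℤ)) : ℤ)
       - (vC (r - 1) d (((i : ℤ) - 1) * (r : ℤ) - (k : ℤ)) : ℤ)

/-- Coefficients of `(1 - x^(n+1)) (1 + x + ⋯ + x^n)^d`. -/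
def aC (n d : ℕ) (p : ℤ) : ℤ := (vC n d p : ℤ) - (vC n d (p - (n + 1)) : ℤ)

lemma vC_zero (n : ℕ) (p : ℤ) : vC n 0 p = if p = 0 then 1 else 0 := by
  unfold vC
  by_cases h : p = 0
  · subst h; simp
  · simp [h, Ne.symm h]

lemma vC_succ (n d : ℕ) (p : ℤ) :
    vC n (d + 1) p = ∑ u : Fin (n + 1), vC n d (p - ((u : ℕ) : ℤ)) := by
  unfold vC
  simp only [Finset.card_filter]
  rw [← (Fin.consEquiv (fun _ : Fin (d + 1) => Fin (n + 1))).sum_comp]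
  rw [Fintype.sum_prod_type]
  refine Finset.sum_congr rfl fun u _ => Finset.sum_congr rfl fun v _ => ?_
  simp only [Fin.consEquiv_apply, Fin.sum_univ_succ, Fin.cons_zero, Fin.cons_succ]
  congr 1
  apply propext
  constructor <;> intro h <;> linarith

lemma vC_symm (n d : ℕ) (p : ℤ) : vC n d (d * n - p) = vC n d p := by
  induction d generalizing p with
  | zero => simp [vC_zero]
  | succ d ih =>
    rw [vC_succ, vC_succ, ← Equiv.sum_comp Fin.revPerm]
    refine Finset.sum_congr rfl fun u _ => ?_
    rw [← ih]
    congr 1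
    have hu : (u : ℕ) ≤ n := by omega
    simp only [Fin.revPerm_apply, Fin.val_rev]
    rw [show n + 1 - ((u : ℕ) + 1) = n - u by omega]
    push_cast [hu]
    ring

lemma vC_neg (n d : ℕ) (p : ℤ) (hp : p < 0) : vC n d p = 0 := by
  induction d generalizing p with
  | zero => simp [vC_zero, hp.ne]
  | succ d ih =>
    rw [vC_succ]
    exact Finset.sum_eq_zero fun u _ => ih _ (by omega)

lemma aC_antisymm (n d : ℕ) (p : ℤ) : aC n d (d * n + n + 1 - p) = - aC n d p := by
  unfold aC
  rw [← vC_symm n d p, ← vC_symm n d (p - (n + 1))]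
  rw [show (d * n + n + 1 - p - (n + 1) : ℤ) = d * n - p by ring,
    show (d * n + n + 1 - p : ℤ) = d * n - (p - (n + 1)) by ring]
  ring

lemma aC_succ (n d : ℕ) (p : ℤ) :
    aC n (d + 1) p = ∑ t ∈ Finset.Ioc (p - (n + 1)) p, aC n d t := by
  have h1 : aC n (d + 1) p = ∑ u ∈ Finset.range (n + 1), aC n d (p - (u : ℤ)) := by
    rw [Finset.sum_range]
    unfold aC
    rw [vC_succ, vC_succ]
    push_cast
    rw [← Finset.sum_sub_distrib]
    refine Finset.sum_congr rfl fun u _ => ?_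
    rw [show p - ((n : ℤ) + 1) - ((u : ℕ) : ℤ) = p - ((u : ℕ) : ℤ) - (n + 1) by ring]
  rw [h1]
  refine Finset.sum_bij (fun u _ => p - (u : ℤ)) ?_ ?_ ?_ ?_
  · intro u hu
    simp only [Finset.mem_range, Finset.mem_Ioc] at *
    omega
  · intro u _ v _ h
    simpa using h
  · intro t ht
    simp only [Finset.mem_Ioc] at ht
    refine ⟨(p - t).toNat, ?_, ?_⟩
    · simp only [Finset.mem_range]; omega
    · omega
  · intro u _; rfl

lemma aC_sum_zero (n d : ℕ) (p : ℤ) :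
    ∑ t ∈ Finset.Ioc (d * n + n - p : ℤ) p, aC n d t = 0 := by
  have h : ∑ t ∈ Finset.Ioc (d * n + n - p : ℤ) p, aC n d t
      = ∑ t ∈ Finset.Ioc (d * n + n - p : ℤ) p, - aC n d t := by
    refine Finset.sum_bij (fun t _ => (d * n + n + 1 - t : ℤ)) ?_ ?_ ?_ ?_
    · intro t ht
      simp only [Finset.mem_Ioc] at *
      constructor <;> linarith
    · intro u _ v _ h
      simpa using h
    · intro t ht
      simp only [Finset.mem_Ioc] at ht
      refine ⟨(d * n + n + 1 - t : ℤ), ?_, by ring⟩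
      simp only [Finset.mem_Ioc]
      constructor <;> linarith
    · intro t _
      rw [aC_antisymm]; ring
  rw [Finset.sum_neg_distrib] at h
  linarith

lemma aC_trunc (n d : ℕ) (p : ℤ) (hp : 2 * p ≤ (d + 1) * n + n + 1) :
    aC n (d + 1) p
      = ∑ t ∈ Finset.Ioc (p - (n + 1)) (min p (d * n + n - p)), aC n d t := by
  rw [aC_succ]
  rcases le_total p (d * n + n - p : ℤ) with h | h
  · rw [min_eq_left h]
  · rw [min_eq_right h]
    have hl : p - (n + 1) ≤ (d * n + n - p : ℤ) := by linarith
    have hU := Finset.Ioc_union_Ioc_eq_Ioc hl h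
    rw [← hU, Finset.sum_union, aC_sum_zero, add_zero]
    rw [Finset.disjoint_left]
    intro t ht ht'
    simp only [Finset.mem_Ioc] at ht ht'
    linarith [ht.2, ht'.1]

lemma aC_nonneg (n d : ℕ) (p : ℤ) (hp : 2 * p ≤ d * n + n + 1) : 0 ≤ aC n d p := by
  induction d generalizing p with
  | zero =>
    unfold aC
    rw [vC_zero, vC_zero]
    have : p - (n + 1) ≠ 0 := by
      push_cast at hp
      intro h
      have : 0 ≤ (n : ℤ) := by positivity
      linarith
    simp [this]
    split <;> simp
  | succ d ih =>
    push_cast at hp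
    rw [aC_trunc n d p hp]
    refine Finset.sum_nonneg fun t ht => ih t ?_
    simp only [Finset.mem_Ioc, le_min_iff] at ht
    linarith [ht.2.1, ht.2.2]

lemma aC_mono (n d : ℕ) (i : ℕ) (p : ℤ) (hi : 2 * i ≤ d + 1) (hp : 2 * p ≤ d * n + n + 1) :
    aC n d p ≤ aC (n + 1) d (p + i) := by
  induction d generalizing p i with
  | zero =>
    obtain rfl : i = 0 := by omega
    unfold aC
    simp only [vC_zero]
    push_cast at *
    have h1 : p - (n + 1) ≠ 0 := by
      intro h
      have : 0 ≤ (n : ℤ) := by positivity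
      linarith
    have h2 : p - (n + 1 + 1) ≠ 0 := by
      intro h
      have : 0 ≤ (n : ℤ) := by positivity
      linarith
    simp only [h1, h2, if_false, add_zero]
    exact le_refl _
  | succ d ih =>
    push_cast at hp
    have hn : 0 ≤ (n : ℤ) := by positivity
    have hiZ : 2 * (i : ℤ) ≤ d + 2 := by exact_mod_cast hi
    have hp' : 2 * (p + i) ≤ ((d : ℤ) + 1) * ((n + 1 : ℕ) : ℤ) + ((n + 1 : ℕ) : ℤ) + 1 := by
      push_cast
      linarith
    rw [aC_trunc n d p hp, aC_trunc (n + 1) d (p + i) hp']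
    obtain ⟨s, hs, hs1, hs2, hs3⟩ : ∃ s : ℕ, 2 * s ≤ d + 1 ∧ s ≤ i ∧ i ≤ s + 1 ∧
        (s : ℤ) + i ≤ d + 1 := by
      rcases Nat.eq_zero_or_pos i with h | h
      · exact ⟨0, by omega, by omega, by omega, by omega⟩
      · exact ⟨i - 1, by omega, by omega, by omega, by omega⟩
    have hs1' : (s : ℤ) ≤ i := by exact_mod_cast hs1
    have hs2' : (i : ℤ) ≤ s + 1 := by exact_mod_cast hs2
    calc _ ≤ ∑ t ∈ Finset.Ioc (p - (n + 1)) (min p (d * n + n - p : ℤ)),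
              aC (n + 1) d (t + s) := by
            refine Finset.sum_le_sum fun t ht => ih s t hs ?_
            simp only [Finset.mem_Ioc, le_min_iff] at ht
            linarith [ht.2.1, ht.2.2]
      _ = ∑ t ∈ (Finset.Ioc (p - (n + 1)) (min p (d * n + n - p : ℤ))).image (· + (s : ℤ)),
              aC (n + 1) d t := by
            rw [Finset.sum_image]
            intro a _ b _ h
            simpa using h
      _ ≤ _ := by
            refine Finset.sum_le_sum_of_subset_of_nonneg ?_ ?_
            · intro t ht
              simp only [Finset.mem_image, Finset.mem_Ioc, le_min_iff] at ht ⊢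
              obtain ⟨a, ⟨h1, h2, h3⟩, rfl⟩ := ht
              push_cast
              refine ⟨?_, ?_, ?_⟩ <;> linarith
            · intro t ht _
              refine aC_nonneg _ _ _ ?_
              simp only [Finset.mem_Ioc, le_min_iff] at ht
              linarith [ht.2.1, ht.2.2]

lemma gHat_eq (n d k i : ℕ) (hk : k ≤ n) :
    gHat (n + 1) d k i = aC n d ((i : ℤ) * (n + 1) - k) := by
  unfold gHat aC
  rw [if_neg (by omega)]
  simp only [Nat.add_sub_cancel]
  split
  · next h =>
    subst h
    rw [vC_neg n d (((0 : ℕ) : ℤ) * (n + 1) - k - (n + 1)) (by push_cast; linarith)]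
    simp
  · push_cast
    congr 3
    ring

/-- Let `1 ≤ d ≤ r` and `0 ≤ k ≤ r`.  Then `g^{r,d}_k ≤ g^{r+1,d}_k` componentwise. -/
theorem stmt_15 (r d k : ℕ) (hd : 1 ≤ d) (hdr : d ≤ r) (hk : k ≤ r) :
    ∀ i : ℕ, i ≤ d / 2 → gHat r d k i ≤ gHat (r + 1) d k i := by
  intro i hi
  have h2 : 2 * (i : ℤ) ≤ d := by omega
  have hdr' : (d : ℤ) ≤ r := by exact_mod_cast hdr
  rw [gHat_eq r d k i hk]
  rcases Nat.lt_or_ge k r with h | h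
  · obtain ⟨n, rfl⟩ : ∃ n, r = n + 1 := ⟨r - 1, by omega⟩
    rw [gHat_eq n d k i (by omega)]
    have := aC_mono n d i ((i : ℤ) * (n + 1) - k) (by omega) (by
      push_cast at hdr'
      nlinarith [mul_le_mul_of_nonneg_right h2 (show (0 : ℤ) ≤ n + 1 by positivity)])
    convert this using 2
    push_cast
    ring
  · have : gHat r d k i = 0 := by unfold gHat; rw [if_pos h]
    rw [this]
    refine aC_nonneg _ _ _ ?_
    nlinarith [mul_le_mul_of_nonneg_right h2 (show (0 : ℤ) ≤ r + 1 by positivity)]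
end

section
/- Let r ≥ d ≥ 1 be integers. Then g^{r,d}_0 is the f-vector of a simplicial complex: there exists a simplicial complex Δ such that the (i+1)-st entry of g^{r,d}_0 equals f_{i−1}(Δ) for all 0 ≤ i ≤ ⌊d/2⌋; that is, C(r−1,d,0) = f_{−1}(Δ) = 1 and C(r−1,d,ir) − C(r−1,d,(i−1)r) = f_{i−1}(Δ) for 1 ≤ i ≤ ⌊d/2⌋. -/
/-- A (finite abstract) simplicial complex: a collection of finite sets closed under
taking subsets and containing the empty set. -/
structure SimpComplex where
  faces : Finset (Finset ℕ)
  empty_mem : ∅ ∈ faces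
  down_closed : ∀ F ∈ faces, ∀ G, G ⊆ F → G ∈ faces

/-- `fVec Δ i = f_{i-1}(Δ)` is the number of faces of `Δ` of cardinality `i`
(i.e. of dimension `i − 1`); in particular `fVec Δ 0 = f_{−1}(Δ) = 1`. -/
def fVec (Δ : SimpComplex) (i : ℕ) : ℕ :=
  (Δ.faces.filter fun F => F.card = i).card

/-- Coefficients of `(1 + x + ... + x^s)^n`. -/
def cc (s : ℕ) : ℕ → ℤ → ℤ
  | 0, j => if j = 0 then 1 else 0
  | n + 1, j => ∑ u ∈ Finset.range (s + 1), cc s n (j - u)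

theorem cc_symm (s n : ℕ) : ∀ j : ℤ, cc s n ((n : ℤ) * s - j) = cc s n j := by
  induction n with
  | zero => intro j; simp [cc]
  | succ n ih =>
    intro j
    rw [cc, cc, ← Finset.sum_range_reflect]
    refine Finset.sum_congr rfl fun u hu => ?_
    rw [← ih]
    have : u ≤ s := by simpa [Nat.lt_succ_iff] using hu
    congr 1
    have h2 : s + 1 - 1 - u = s - u := by omega
    rw [h2]
    push_cast [this]
    ring

theorem cc_diff (s n : ℕ) (j : ℤ) :
    cc s (n + 1) j - cc s (n + 1) (j - 1) = cc s n j - cc s n (j - s - 1) := by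
  rw [cc, cc, ← Finset.sum_sub_distrib]
  have := Finset.sum_range_sub' (fun u : ℕ => cc s n (j - u)) (s + 1)
  simp only [Nat.cast_zero, sub_zero, Nat.cast_add, Nat.cast_one] at this
  rw [sub_sub, ← this]
  refine Finset.sum_congr rfl fun u hu => ?_
  congr 2
  ring

theorem vC_eq (s n : ℕ) : ∀ j : ℤ, (vC s n j : ℤ) = cc s n j := by
  induction n with
  | zero => intro j; by_cases h : j = 0 <;> simp [vC, cc, h, eq_comm]
  | succ n ih =>
    intro j
    rw [cc, Finset.sum_range]
    simp_rw [← ih]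
    rw [← Nat.cast_sum]
    congr 1
    unfold vC
    simp_rw [Finset.card_filter]
    rw [← (Fin.consEquiv (fun _ : Fin (n + 1) => Fin (s + 1))).sum_comp, Fintype.sum_prod_type]
    refine Finset.sum_congr rfl fun u _ => Finset.sum_congr rfl fun v _ => ?_
    simp only [Fin.consEquiv, Equiv.coe_fn_mk, Fin.sum_univ_succ, Fin.cons_zero, Fin.cons_succ]
    congr 1
    apply propext
    constructor <;> intro h <;> linarith

/-- The ballot order ideal of multisets. -/
def WW (s : ℕ) : ℕ → Finset (Multiset ℕ)
  | 0 => {0}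
  | n + 1 => ((WW s n ×ˢ Finset.range (s + 1)).filter
      fun p => p.2 + 2 * p.1.card ≤ n * s).image fun p => p.1 + Multiset.replicate p.2 n

theorem WW_succ (s n : ℕ) (v : Multiset ℕ) : v ∈ WW s (n + 1) ↔
    ∃ w ∈ WW s n, ∃ u ≤ s, u + 2 * w.card ≤ n * s ∧ w + Multiset.replicate u n = v := by
  simp only [WW, Finset.mem_image, Finset.mem_filter, Finset.mem_product, Finset.mem_range,
    Prod.exists, Nat.lt_succ_iff]
  constructor
  · rintro ⟨w, u, ⟨⟨h1, h2⟩, h3⟩, h4⟩; exact ⟨w, h1, u, h2, h3, h4⟩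
  · rintro ⟨w, h1, u, h2, h3, h4⟩; exact ⟨w, u, ⟨⟨h1, h2⟩, h3⟩, h4⟩

theorem WW_lt (s n : ℕ) : ∀ v ∈ WW s n, ∀ a ∈ v, a < n := by
  induction n with
  | zero => intro v hv; simp [WW] at hv; simp [hv]
  | succ n ih =>
    intro v hv a ha
    obtain ⟨w, hw, u, -, -, rfl⟩ := (WW_succ s n v).1 hv
    rcases Multiset.mem_add.1 ha with h | h
    · exact (ih w hw a h).trans (Nat.lt_succ_self n)
    · rw [Multiset.eq_of_mem_replicate h]; exact Nat.lt_succ_self n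

theorem WW_count_self (s n : ℕ) (v) (hv : v ∈ WW s n) : v.count n = 0 :=
  Multiset.count_eq_zero.2 fun h => (WW_lt s n v hv n h).false

theorem WW_count (s n : ℕ) : ∀ v ∈ WW s n, ∀ a, v.count a ≤ s := by
  induction n with
  | zero => intro v hv; simp [WW] at hv; simp [hv]
  | succ n ih =>
    intro v hv a
    obtain ⟨w, hw, u, hu, -, rfl⟩ := (WW_succ s n v).1 hv
    rw [Multiset.count_add, Multiset.count_replicate]
    split_ifs with h
    · subst h; rw [WW_count_self s _ w hw]; omega
    · simpa using ih w hw a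

theorem WW_down (s n : ℕ) : ∀ v ∈ WW s n, ∀ w ≤ v, w ∈ WW s n := by
  induction n with
  | zero => intro v hv w hw; simp [WW] at hv; subst hv; simpa [WW] using hw
  | succ n ih =>
    intro v hv x hx
    obtain ⟨w, hw, u, hu, h3, rfl⟩ := (WW_succ s n v).1 hv
    have hle : x.filter (fun a => ¬ a = n) ≤ w := by
      rw [Multiset.le_iff_count]
      intro a
      rw [Multiset.count_filter, ite_not]
      split_ifs with h
      · exact Nat.zero_le _
      · have := Multiset.le_iff_count.1 hx a
        rw [Multiset.count_add, Multiset.count_replicate] at this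
        simpa [Ne.symm h] using this
    have hc : x.count n ≤ u := by
      have := Multiset.le_iff_count.1 hx n
      rw [Multiset.count_add, WW_count_self s n w hw] at this
      simpa using this
    refine (WW_succ s n x).2 ⟨_, ih w hw _ hle, x.count n, hc.trans hu, ?_, ?_⟩
    · have := Multiset.card_le_card hle
      omega
    · rw [← Multiset.filter_eq' x n, add_comm, Multiset.filter_add_not]

/-- Number of elements of the ideal of degree `j`. -/
def mm (s n : ℕ) (j : ℤ) : ℤ := (((WW s n).filter fun w => (w.card : ℤ) = j).card : ℤ)

theorem mm_succ (s n : ℕ) (j : ℤ) : mm s (n + 1) j =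
    ∑ u ∈ Finset.range (s + 1), if (u : ℤ) + 2 * (j - u) ≤ n * s then mm s n (j - u) else 0 := by
  unfold mm
  rw [WW, Finset.filter_image, Finset.card_image_of_injOn]
  · rw [Finset.filter_filter, Finset.card_filter, Finset.sum_product_right]
    push_cast
    refine Finset.sum_congr rfl fun u _ => ?_
    rw [Finset.card_filter]
    push_cast
    split_ifs with h
    · refine Finset.sum_congr rfl fun w _ => ?_
      congr 1
      apply propext
      simp only [Multiset.card_add, Multiset.card_replicate, Nat.cast_add]
      constructor
      · rintro ⟨-, h⟩; linarith
      · intro h'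
        refine ⟨?_, by linarith⟩
        rw [← h'] at h; exact_mod_cast h
    · refine Finset.sum_eq_zero fun w _ => if_neg ?_
      simp only [Multiset.card_add, Multiset.card_replicate, Nat.cast_add]
      rintro ⟨h1, h2⟩
      apply h
      have : j - u = w.card := by linarith
      rw [this]; exact_mod_cast h1
  · rintro ⟨w, u⟩ h ⟨w', u'⟩ h' heq
    simp only [Finset.coe_filter, Finset.mem_filter, Finset.mem_product, Set.mem_ofPred_eq] at h h' heq
    have h1 := WW_count_self s n w h.1.1.1
    have h2 := WW_count_self s n w' h'.1.1.1
    have h3 := congrArg (Multiset.count n) heq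
    simp only [Multiset.count_add, Multiset.count_replicate_self, h1, h2, zero_add] at h3
    subst h3
    simpa using heq

theorem tele (f : ℕ → ℤ) (t N : ℕ) (h : t ≤ N) :
    (∑ u ∈ Finset.range N, if t ≤ u then f u - f (u + 1) else 0) = f t - f N := by
  induction N, h using Nat.le_induction with
  | base =>
    rw [sub_self]
    refine Finset.sum_eq_zero fun u hu => if_neg ?_
    simpa using hu
  | succ N h ih => rw [Finset.sum_range_succ, ih, if_pos h]; ring

theorem mm_aux (s n : ℕ) (ih : ∀ j : ℤ, 2 * j ≤ n * s + 1 → mm s n j = cc s n j - cc s n (j - 1))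
    (j : ℤ) (hj : 2 * j ≤ (n + 1) * s + 1) :
    mm s (n + 1) j = cc s n j - cc s n (j - s - 1) := by
  have key : ∀ t : ℕ, t ≤ s + 1 → (∀ u : ℕ, (u : ℤ) + 2 * (j - u) ≤ n * s ↔ t ≤ u) →
      mm s (n + 1) j = cc s n (j - t) - cc s n (j - s - 1) := by
    intro t ht hiff
    have := tele (fun u => cc s n (j - u)) t (s + 1) ht
    rw [sub_sub j]
    simp only [Nat.cast_add, Nat.cast_one] at this
    rw [← this, mm_succ]
    refine Finset.sum_congr rfl fun u _ => ?_
    simp only [hiff]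
    split_ifs with h
    · rw [ih, sub_sub]
      have := (hiff u).2 h
      linarith [Int.natCast_nonneg u]
    · rfl
  by_cases h : 2 * j ≤ n * s
  · have := key 0 (Nat.zero_le _) (fun u => by
      constructor
      · intro _; exact Nat.zero_le _
      · intro _; linarith [Int.natCast_nonneg u])
    simpa using this
  · obtain ⟨t, ht⟩ := Int.eq_ofNat_of_zero_le (show 0 ≤ 2 * j - n * s by linarith)
    have ht' : (t : ℤ) = 2 * j - n * s := ht.symm
    rw [key t]
    · rw [← cc_symm s n j, ht']
      congr 2; ring
    · have : (t : ℤ) ≤ s + 1 := by rw [ht']; linarith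
      exact_mod_cast this
    · intro u
      rw [← Int.ofNat_le (m := t), ht']
      constructor <;> intro h <;> linarith

theorem mm_eq (s n : ℕ) : ∀ j : ℤ, 2 * j ≤ n * s + 1 →
    mm s n j = cc s n j - cc s n (j - 1) := by
  induction n with
  | zero =>
    intro j hj
    have hj : j ≤ 0 := by simp at hj; omega
    have : ¬ (j - 1 = 0) := by omega
    by_cases h : j = 0
    · simp [mm, cc, WW, h, Finset.filter_singleton]
    · simp [mm, cc, WW, h, this, Finset.filter_singleton, Ne.symm h]
  | succ n ih =>
    intro j hj
    rw [cc_diff]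
    exact mm_aux s n ih j (by exact_mod_cast hj)

/-- Elementwise comparison of blocks. -/
def BRel (B C : Multiset ℕ) : Prop := ∀ x ∈ B, ∀ y ∈ C, x ≤ y

/-- Faces before encoding. -/
def Face (r : ℕ) (F : Finset (Multiset ℕ)) : Prop :=
  (∀ B ∈ F, B.card = r) ∧ ∀ B ∈ F, ∀ C ∈ F, B ≠ C → BRel B C ∨ BRel C B

theorem Face.mono {r : ℕ} {F G : Finset (Multiset ℕ)} (h : Face r F) (hG : G ⊆ F) : Face r G :=
  ⟨fun B hB => h.1 B (hG hB), fun B hB C hC => h.2 B (hG hB) C (hG hC)⟩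

theorem Face.exists_min {r : ℕ} (hr : 0 < r) (F : Finset (Multiset ℕ)) :
    Face r F → F.Nonempty → ∃ B ∈ F, ∀ C ∈ F, C ≠ B → BRel B C := by
  induction F using Finset.induction_on with
  | empty => rintro - ⟨x, hx⟩; simp at hx
  | insert A F hA ih =>
    intro h _
    rcases F.eq_empty_or_nonempty with rfl | hne
    · exact ⟨A, by simp, by simp⟩
    obtain ⟨B, hB, hmin⟩ := ih (h.mono (Finset.subset_insert A F)) hne
    have hAB : A ≠ B := by rintro rfl; exact hA hB
    rcases h.2 A (by simp) B (by simp [hB]) hAB with h1 | h1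
    · refine ⟨A, by simp, fun C hC hCA => ?_⟩
      have hC : C ∈ F := by
        rcases Finset.mem_insert.1 hC with h | h
        · exact absurd h hCA
        · exact h
      by_cases hCB : C = B
      · rw [hCB]; exact h1
      · intro x hx y hy
        have : 0 < B.card := by rw [h.1 B (by simp [hB])]; exact hr
        obtain ⟨z, hz⟩ := Multiset.card_pos_iff_exists_mem.1 this
        exact (h1 x hx z hz).trans (hmin C hC hCB z hz y hy)
    · refine ⟨B, by simp [hB], fun C hC hCB => ?_⟩
      rcases Finset.mem_insert.1 hC with rfl | h
      · exact h1
      · exact hmin C h hCB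

theorem block_unique {w B C : Multiset ℕ} (hB : B ≤ w) (hC : C ≤ w) (hcard : B.card = C.card)
    (h1 : BRel B (w - B)) (h2 : BRel C (w - C)) : B = C := by
  by_contra hne
  have ha : ∃ a, C.count a < B.count a := by
    by_contra! hh
    exact hne (Multiset.eq_of_le_of_card_le (Multiset.le_iff_count.2 hh) hcard.ge)
  have hb : ∃ a, B.count a < C.count a := by
    by_contra! hh
    exact hne (Multiset.eq_of_le_of_card_le (Multiset.le_iff_count.2 hh) hcard.le).symm
  obtain ⟨a, ha⟩ := ha
  obtain ⟨b, hb⟩ := hb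
  have haw := Multiset.le_iff_count.1 hB a
  have hbw := Multiset.le_iff_count.1 hC b
  have e1 : a ≤ b := h1 a (Multiset.count_pos.1 (by omega)) b
    (Multiset.count_pos.1 (by rw [Multiset.count_sub]; omega))
  have e2 : b ≤ a := h2 b (Multiset.count_pos.1 (by omega)) a
    (Multiset.count_pos.1 (by rw [Multiset.count_sub]; omega))
  have : a = b := le_antisymm e1 e2
  subst this
  omega

theorem block_exists (r : ℕ) : ∀ w : Multiset ℕ, r ≤ w.card →
    ∃ B ≤ w, B.card = r ∧ BRel B (w - B) := by
  intro w hw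
  refine ⟨((w.sort (· ≤ ·)).take r : List ℕ), ?_, ?_, ?_⟩
  · conv_rhs => rw [← Multiset.sort_eq w (· ≤ ·)]
    exact Multiset.coe_le.2 (List.take_sublist _ _).subperm
  · simp [hw]
  · have h : w - ((w.sort (· ≤ ·)).take r : List ℕ) = ((w.sort (· ≤ ·)).drop r : List ℕ) := by
      have h0 : w = ((w.sort (· ≤ ·)).take r : List ℕ) + ((w.sort (· ≤ ·)).drop r : List ℕ) := by
        rw [Multiset.coe_add, List.take_append_drop, Multiset.sort_eq]
      conv_lhs => enter [1]; rw [h0]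
      rw [add_tsub_cancel_left]
    rw [h]
    intro x hx y hy
    have hp : (w.sort (· ≤ ·)).Pairwise (· ≤ ·) := Multiset.pairwise_sort w (· ≤ ·)
    rw [← List.take_append_drop r (w.sort (· ≤ ·)), List.pairwise_append] at hp
    exact hp.2.2 x (by simpa using hx) y (by simpa using hy)

theorem mem_le_sum (F : Finset (Multiset ℕ)) (B : Multiset ℕ) (hB : B ∈ F) : B ≤ ∑ C ∈ F, C :=
  Finset.single_le_sum (f := fun C : Multiset ℕ => C) (fun _ _ => Multiset.zero_le _) hB

theorem face_min_sub {F : Finset (Multiset ℕ)} {B : Multiset ℕ} (hB : B ∈ F)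
    (hm : ∀ C ∈ F, C ≠ B → BRel B C) :
    (∑ C ∈ F, C) - B = ∑ C ∈ F.erase B, C ∧ BRel B ((∑ C ∈ F, C) - B) := by
  have h : (∑ C ∈ F, C) - B = ∑ C ∈ F.erase B, C := by
    rw [← Finset.add_sum_erase F (fun C => C) hB, add_tsub_cancel_left]
  refine ⟨h, ?_⟩
  rw [h]
  intro x hx y hy
  obtain ⟨C, hC, hyC⟩ := Multiset.mem_sum.1 hy
  rw [Finset.mem_erase] at hC
  exact hm C hC.2 hC.1 x hx y hyC

theorem face_inj {r : ℕ} (hr : 0 < r) (i : ℕ) : ∀ F G : Finset (Multiset ℕ), Face r F → Face r G →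
    F.card = i → G.card = i → ∑ C ∈ F, C = ∑ C ∈ G, C → F = G := by
  induction i with
  | zero =>
    intro F G _ _ hF hG _
    rw [Finset.card_eq_zero.1 hF, Finset.card_eq_zero.1 hG]
  | succ i ih =>
    intro F G hF hG cF cG hs
    obtain ⟨B, hB, hBm⟩ := Face.exists_min hr F hF (Finset.card_pos.1 (by omega))
    obtain ⟨C, hC, hCm⟩ := Face.exists_min hr G hG (Finset.card_pos.1 (by omega))
    have f1 := face_min_sub hB hBm
    have f2 := face_min_sub hC hCm
    have hBC : B = C := by
      refine block_unique (w := ∑ C ∈ F, C) (mem_le_sum F B hB) ?_ ?_ f1.2 ?_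
      · rw [hs]; exact mem_le_sum G C hC
      · rw [hF.1 B hB, hG.1 C hC]
      · rw [hs]; exact f2.2
    subst hBC
    have := ih (F.erase B) (G.erase B) (hF.mono (Finset.erase_subset _ _))
      (hG.mono (Finset.erase_subset _ _)) (by rw [Finset.card_erase_of_mem hB]; omega)
      (by rw [Finset.card_erase_of_mem hC]; omega) (by rw [← f1.1, ← f2.1, hs])
    rw [← Finset.insert_erase hB, this, Finset.insert_erase hC]

theorem face_surj {r : ℕ} (hr : 0 < r) (i : ℕ) : ∀ w : Multiset ℕ, (∀ a, w.count a < r) →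
    w.card = i * r → ∃ F, Face r F ∧ F.card = i ∧ ∑ C ∈ F, C = w := by
  induction i with
  | zero =>
    intro w _ hc
    have : w = 0 := by simpa using hc
    exact ⟨∅, ⟨by simp, by simp⟩, by simp, by simp [this]⟩
  | succ i ih =>
    intro w hw hc
    obtain ⟨B, hBw, hBc, hBr⟩ := block_exists r w (by rw [hc]; nlinarith)
    obtain ⟨F, hF, cF, sF⟩ := ih (w - B)
      (fun a => (Multiset.le_iff_count.1 (Multiset.sub_le_self w B) a).trans_lt (hw a))
      (by rw [Multiset.card_sub hBw, hc, hBc, Nat.succ_mul]; omega)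
    have hrel : ∀ C ∈ F, BRel B C := fun C hC x hx y hy =>
      hBr x hx y (Multiset.mem_of_le (sF ▸ mem_le_sum F C hC) hy)
    have hBF : B ∉ F := by
      intro hB
      have hBB := hrel B hB
      obtain ⟨a, ha⟩ := Multiset.card_pos_iff_exists_mem.1 (show 0 < B.card by omega)
      have : B = Multiset.replicate r a := Multiset.eq_replicate.2
        ⟨hBc, fun b hb => le_antisymm (hBB b hb a ha) (hBB a ha b hb)⟩
      have h1 := Multiset.le_iff_count.1 hBw a
      rw [this, Multiset.count_replicate_self] at h1
      exact absurd (hw a) (by omega)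
    refine ⟨insert B F, ⟨?_, ?_⟩, ?_, ?_⟩
    · intro C hC
      rcases Finset.mem_insert.1 hC with rfl | h
      · exact hBc
      · exact hF.1 C h
    · intro C hC D hD hCD
      rcases Finset.mem_insert.1 hC with rfl | h
      · rcases Finset.mem_insert.1 hD with rfl | h'
        · exact absurd rfl hCD
        · exact Or.inl (hrel D h')
      · rcases Finset.mem_insert.1 hD with rfl | h'
        · exact Or.inr (hrel C h)
        · exact hF.2 C h D h' hCD
    · rw [Finset.card_insert_of_notMem hBF, cF]
    · rw [Finset.sum_insert hBF, sF, add_tsub_cancel_of_le hBw]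

open Classical in
/-- The complex before encoding. -/
noncomputable def KK (s n : ℕ) : Finset (Finset (Multiset ℕ)) :=
  (WW s n).powerset.filter fun F => Face (s + 1) F ∧ ∑ C ∈ F, C ∈ WW s n

theorem mem_KK (s n : ℕ) (F) : F ∈ KK s n ↔ Face (s + 1) F ∧ ∑ C ∈ F, C ∈ WW s n := by
  classical
  rw [KK, Finset.mem_filter, Finset.mem_powerset]
  refine ⟨fun h => h.2, fun h => ⟨fun B hB => ?_, h⟩⟩
  exact WW_down s n _ h.2 B (mem_le_sum F B hB)

theorem zero_mem_WW (s n : ℕ) : 0 ∈ WW s n := by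
  induction n with
  | zero => simp [WW]
  | succ n ih => exact (WW_succ s n 0).2 ⟨0, ih, 0, by simp, by simp, by simp⟩

theorem KK_card (s n i : ℕ) : (((KK s n).filter fun F => F.card = i).card : ℤ) =
    mm s n ((i : ℤ) * ((s : ℤ) + 1)) := by
  unfold mm
  congr 1
  refine Finset.card_bij (fun F _ => ∑ C ∈ F, C) ?_ ?_ ?_
  · intro F hF
    rw [Finset.mem_filter, mem_KK] at hF
    rw [Finset.mem_filter]
    refine ⟨hF.1.2, ?_⟩
    rw [Multiset.card_sum, Finset.sum_congr rfl hF.1.1.1]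
    simp [hF.2]
  · intro F hF G hG h
    rw [Finset.mem_filter, mem_KK] at hF hG
    exact face_inj (Nat.succ_pos s) i F G hF.1.1 hG.1.1 hF.2 hG.2 h
  · intro w hw
    rw [Finset.mem_filter] at hw
    obtain ⟨F, h1, h2, h3⟩ := face_surj (Nat.succ_pos s) i w
      (fun a => Nat.lt_succ_of_le (WW_count s n w hw.1 a)) (by exact_mod_cast hw.2)
    refine ⟨F, ?_, h3⟩
    rw [Finset.mem_filter, mem_KK, h3]
    exact ⟨⟨h1, hw.1⟩, h2⟩

/-- The simplicial complex. -/
noncomputable def theComplex (s n : ℕ) : SimpComplex where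
  faces := (KK s n).map
    (Finset.mapEmbedding (Encodable.encode' (Multiset ℕ))).toEmbedding
  empty_mem := by
    rw [Finset.mem_map]
    refine ⟨∅, (mem_KK s n ∅).2 ⟨⟨by simp, by simp⟩, by simpa using zero_mem_WW s n⟩, ?_⟩
    simp
  down_closed := by
    intro F hF G hG
    rw [Finset.mem_map] at hF ⊢
    obtain ⟨F', hF', rfl⟩ := hF
    obtain ⟨G', hG', rfl⟩ := Finset.subset_map_iff.1 hG
    have hG' : G' ⊆ F' := hG'
    refine ⟨G', ?_, rfl⟩
    rw [mem_KK] at hF' ⊢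
    refine ⟨hF'.1.mono hG', WW_down s n _ hF'.2 _ ?_⟩
    exact Finset.sum_le_sum_of_subset hG'

theorem fVec_theComplex (s n i : ℕ) :
    (fVec (theComplex s n) i : ℤ) = mm s n ((i : ℤ) * ((s : ℤ) + 1)) := by
  rw [← KK_card, fVec, theComplex, Finset.filter_map, Finset.card_map]
  congr 2
  ext F
  simp

theorem cc_neg (s n : ℕ) : ∀ j : ℤ, j < 0 → cc s n j = 0 := by
  induction n with
  | zero => intro j hj; rw [cc, if_neg hj.ne]
  | succ n ih =>
    intro j hj
    rw [cc]
    exact Finset.sum_eq_zero fun u _ => ih _ (by omega)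

/-- Let `r ≥ d ≥ 1`.  Then `g^{r,d}_0` is the `f`-vector of a simplicial complex:
there is a simplicial complex `Δ` whose `(i+1)`-st entry equals `f_{i−1}(Δ)` for
`0 ≤ i ≤ ⌊d/2⌋`, i.e. `C(r−1,d,0) = f_{−1}(Δ) = 1` and
`C(r−1,d,ir) − C(r−1,d,(i−1)r) = f_{i−1}(Δ)` for `1 ≤ i ≤ ⌊d/2⌋`. -/
theorem stmt_18 (r d : ℕ) (hd : 1 ≤ d) (hdr : d ≤ r) :
    ∃ Δ : SimpComplex, ∀ i : ℕ, i ≤ d / 2 → gHat r d 0 i = (fVec Δ i : ℤ) := by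
  obtain ⟨s, rfl⟩ : ∃ s, r = s + 1 := ⟨r - 1, by omega⟩
  refine ⟨theComplex s (d + 1), fun i hi => ?_⟩
  rw [fVec_theComplex, mm_aux s d (mm_eq s d)]
  · rw [gHat, if_neg (by omega)]
    simp only [Nat.add_sub_cancel, vC_eq]
    split_ifs with h
    · subst h
      rw [cc_neg s d _ (show ((0 : ℕ) : ℤ) * (s + 1) - s - 1 < 0 by push_cast; omega)]
      simp
    · push_cast
      congr 2 <;> ring
  · have h1 : 2 * (i : ℤ) ≤ d := by omega
    have h2 : (d : ℤ) ≤ s + 1 := by exact_mod_cast hdr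
    nlinarith [mul_le_mul_of_nonneg_right h1 (show (0 : ℤ) ≤ s + 1 by omega)]
end
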